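/- Let |ψ⟩ be a fully entangled stabilizer state on n ≥ 3 qubits whose stabilizer 𝒮(ψ) corresponds, under the standard encoding σ₀ ↦ 0, σ_z ↦ 1, σₓ ↦ ξ, σ_y ↦ ξ², to a GF(4)-linear code in GF(4)ⁿ (i.e., an additive code closed under scalar multiplication by ξ). Then LU(ψ) = LC(ψ). -/

import Mathlib

open Matrix

noncomputable section

/-- Pauli matrices: `0 ↦ σ₀` (identity), `1 ↦ σₓ`, `2 ↦ σ_y`, `3 ↦ σ_z`. -/
def pauliMat : Fin 4 → Matrix (Fin 2) (Fin 2) ℂ :=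
  ![1, !![0, 1; 1, 0], !![0, -Complex.I; Complex.I, 0], !![1, 0; 0, -1]]

/-- Tensor (Kronecker) product of a family of one-qubit operators, as an operator
on qubits indexed by `ι`. -/
def kron {ι : Type} [Fintype ι] (U : ι → Matrix (Fin 2) (Fin 2) ℂ) :
    Matrix (ι → Fin 2) (ι → Fin 2) ℂ :=
  Matrix.of fun x y => ∏ i, U i (x i) (y i)

/-- An element of the Pauli group: a phase in `{1, -1, i, -i}` together with a
Pauli label (`σ₀, σₓ, σ_y, σ_z`) on every qubit. -/
structure PauliOp (ι : Type) where
  phase : ℂ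
  label : ι → Fin 4
  phase_ok : phase = 1 ∨ phase = -1 ∨ phase = Complex.I ∨ phase = -Complex.I

noncomputable instance {ι : Type} : DecidableEq (PauliOp ι) := Classical.decEq _

/-- The matrix of a Pauli group element. -/
def PauliOp.toMatrix {ι : Type} [Fintype ι] (M : PauliOp ι) :
    Matrix (ι → Fin 2) (ι → Fin 2) ℂ :=
  M.phase • kron fun i => pauliMat (M.label i)

/-- The support of a Pauli operator: the set of qubits on which it acts nontrivially. -/
def PauliOp.support {ι : Type} [Fintype ι] [DecidableEq ι] (M : PauliOp ι) : Finset ι :=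
  Finset.univ.filter fun i => M.label i ≠ 0

/-- A (maximal) stabilizer on the qubits indexed by `ι`: an abelian subgroup of the
Pauli group of cardinality `2^|ι|` which does not contain `-I`. -/
structure Stabilizer (ι : Type) [Fintype ι] [DecidableEq ι] where
  elems : Finset (PauliOp ι)
  one_mem : ∃ M ∈ elems, PauliOp.toMatrix M = 1
  mul_mem : ∀ M ∈ elems, ∀ N ∈ elems, ∃ K ∈ elems,
    PauliOp.toMatrix K = PauliOp.toMatrix M * PauliOp.toMatrix N
  comm : ∀ M ∈ elems, ∀ N ∈ elems,
    PauliOp.toMatrix M * PauliOp.toMatrix N = PauliOp.toMatrix N * PauliOp.toMatrix M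
  neg_one_not_mem : ∀ M ∈ elems, PauliOp.toMatrix M ≠ -1
  card_elems : elems.card = 2 ^ Fintype.card ι

variable {ι : Type} [Fintype ι] [DecidableEq ι]

/-- `ψ` is the stabilizer state of the stabilizer `S`: it is a unit vector fixed by
every element of `S`. -/
def stabilizesState (S : Stabilizer ι) (ψ : (ι → Fin 2) → ℂ) : Prop :=
  (∑ x, Complex.normSq (ψ x)) = 1 ∧ ∀ M ∈ S.elems, (PauliOp.toMatrix M).mulVec ψ = ψ

/-- `ψ` is a stabilizer state. -/
def IsStabilizerState (ψ : (ι → Fin 2) → ℂ) : Prop :=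
  ∃ S : Stabilizer ι, stabilizesState S ψ

/-- `A_ω(ψ)`: the number of stabilizer elements with support exactly `ω`. -/
def Aomega (S : Stabilizer ι) (ω : Finset ι) : ℕ :=
  (S.elems.filter fun M => PauliOp.support M = ω).card

/-- `ω` is a minimal support of `S`: it is the support of some element of `S`, and no
element of `S` has nonempty support strictly contained in `ω`. -/
def IsMinimalSupport (S : Stabilizer ι) (ω : Finset ι) : Prop :=
  (∃ M ∈ S.elems, PauliOp.support M = ω) ∧
    ∀ M ∈ S.elems, PauliOp.support M ⊂ ω → PauliOp.support M = ∅

/-- The matrices of the minimal elements of `S` (the elements whose support is a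
minimal support). -/
def minimalMatrices (S : Stabilizer ι) : Set (Matrix (ι → Fin 2) (ι → Fin 2) ℂ) :=
  {A | ∃ M ∈ S.elems, IsMinimalSupport S (PauliOp.support M) ∧ PauliOp.toMatrix M = A}

/-- `M` belongs to the subgroup `ℳ(ψ)` of `S` generated by the minimal elements.
(Every stabilizer element is an involution, so the generated submonoid coincides with
the generated subgroup.) -/
def inMinimalSubgroup (S : Stabilizer ι) (M : PauliOp ι) : Prop :=
  M ∈ S.elems ∧ PauliOp.toMatrix M ∈ Submonoid.closure (minimalMatrices S)

/-- A one-qubit Clifford operation: a unitary mapping each of the three Pauli matrices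
to a Pauli matrix, up to sign, under conjugation. -/
def IsClifford (U : Matrix (Fin 2) (Fin 2) ℂ) : Prop :=
  U ∈ Matrix.unitaryGroup (Fin 2) ℂ ∧
    ∃ π : Equiv.Perm (Fin 3), ∀ u : Fin 3, ∃ s : ℂ, (s = 1 ∨ s = -1) ∧
      U * pauliMat u.succ * Uᴴ = s • pauliMat (π u).succ

/-- Local unitary equivalence of pure states. -/
def LUequiv (ψ φ : (ι → Fin 2) → ℂ) : Prop :=
  ∃ U : ι → Matrix (Fin 2) (Fin 2) ℂ,
    (∀ i, U i ∈ Matrix.unitaryGroup (Fin 2) ℂ) ∧ (kron U).mulVec ψ = φ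

/-- Local Clifford equivalence of pure states. -/
def LCequiv (ψ φ : (ι → Fin 2) → ℂ) : Prop :=
  ∃ U : ι → Matrix (Fin 2) (Fin 2) ℂ,
    (∀ i, IsClifford (U i)) ∧ (kron U).mulVec ψ = φ

/-- Local Clifford equivalence of (possibly mixed) states. -/
def LCequivMixed (ρ ρ' : Matrix (ι → Fin 2) (ι → Fin 2) ℂ) : Prop :=
  ∃ U : ι → Matrix (Fin 2) (Fin 2) ℂ,
    (∀ i, IsClifford (U i)) ∧ kron U * ρ * (kron U)ᴴ = ρ'

/-- A pure state is fully entangled if it is not a tensor product of states on two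
complementary nonempty subsets of the qubits. -/
def FullyEntangled (ψ : (ι → Fin 2) → ℂ) : Prop :=
  ¬ ∃ (ω : Finset ι) (φ : ({i // i ∈ ω} → Fin 2) → ℂ) (χ : ({i // i ∉ ω} → Fin 2) → ℂ),
      ω ≠ ∅ ∧ ω ≠ Finset.univ ∧
        ∀ x : ι → Fin 2, ψ x = φ (fun i => x i.1) * χ (fun i => x i.1)

/-- Recombine an assignment on `ω` and one on its complement into a global assignment. -/
def mergeAssign (ω : Finset ι) (x : {i // i ∈ ω} → Fin 2) (z : {i // i ∉ ω} → Fin 2) :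
    ι → Fin 2 :=
  fun i => if h : i ∈ ω then x ⟨i, h⟩ else z ⟨i, h⟩

/-- The reduced density matrix `ρ_ω(ψ)` of the pure state `ψ` on the qubits in `ω`
(partial trace of `|ψ⟩⟨ψ|` over the qubits outside `ω`). -/
def reducedState (ψ : (ι → Fin 2) → ℂ) (ω : Finset ι) :
    Matrix ({i // i ∈ ω} → Fin 2) ({i // i ∈ ω} → Fin 2) ℂ :=
  Matrix.of fun x y =>
    ∑ z : {i // i ∉ ω} → Fin 2, ψ (mergeAssign ω x z) * (starRingEnd ℂ) (ψ (mergeAssign ω y z))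

/-- The restriction `α_M M_{i₁} ⊗ ⋯ ⊗ M_{i_k}` of a Pauli operator to the qubits in `ω`. -/
def PauliOp.restrict (M : PauliOp ι) (ω : Finset ι) :
    Matrix ({i // i ∈ ω} → Fin 2) ({i // i ∈ ω} → Fin 2) ℂ :=
  M.phase • kron fun i : {i // i ∈ ω} => pauliMat (M.label i.1)

/-- The `n`-qubit GHZ state `(|0…0⟩ + |1…1⟩)/√2`. -/
def ghz (n : ℕ) : (Fin n → Fin 2) → ℂ :=
  fun x => if x = (fun _ => 0) ∨ x = (fun _ => 1) then ((Real.sqrt 2 : ℝ)⁻¹ : ℂ) else 0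

/-- The `2n × 2n` binary symplectic form `P = [[0, I], [I, 0]]`. -/
def Pmat (n : ℕ) : Matrix (Fin n ⊕ Fin n) (Fin n ⊕ Fin n) (ZMod 2) :=
  Matrix.fromBlocks 0 1 1 0

end

/-- The standard encoding of Pauli labels into GF(4):
`σ₀ ↦ 0, σ_z ↦ 1, σₓ ↦ ξ, σ_y ↦ ξ²` (labels: `0 = σ₀, 1 = σₓ, 2 = σ_y, 3 = σ_z`). -/
noncomputable def pauliToGF4 (ξ : GaloisField 2 2) : Fin 4 → GaloisField 2 2 :=
  ![0, ξ, ξ ^ 2, 1]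

/-- The additive code over GF(4) corresponding to a stabilizer. -/
noncomputable def gf4Code {n : ℕ} (ξ : GaloisField 2 2) (S : Stabilizer (Fin n)) :
    Set (Fin n → GaloisField 2 2) :=
  {c | ∃ M ∈ S.elems, ∀ i, c i = pauliToGF4 ξ (M.label i)}

theorem kron_mul {ι : Type} [Fintype ι] [DecidableEq ι] (U V : ι → Matrix (Fin 2) (Fin 2) ℂ) :
    kron U * kron V = kron (fun i => U i * V i) := by
  ext x z
  simp only [kron, Matrix.mul_apply, Matrix.of_apply, ← Finset.prod_mul_distrib, Fintype.prod_sum]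

theorem kron_conjTranspose {ι : Type} [Fintype ι] (U : ι → Matrix (Fin 2) (Fin 2) ℂ) :
    (kron U)ᴴ = kron (fun i => (U i)ᴴ) := by
  ext x z
  simp [kron, Matrix.conjTranspose_apply]

theorem kron_one {ι : Type} [Fintype ι] [DecidableEq ι] : kron (fun _ : ι => 1) = 1 := by
  ext x y
  simp only [kron, Matrix.of_apply, Matrix.one_apply, Finset.prod_ite_zero, funext_iff]
  simp

theorem kron_smul {ι : Type} [Fintype ι] (c : ι → ℂ) (U : ι → Matrix (Fin 2) (Fin 2) ℂ) :
    kron (fun i => c i • U i) = (∏ i, c i) • kron U := by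
  ext x y
  simp [kron, Finset.prod_mul_distrib]

theorem kron_sum {ι : Type} [Fintype ι] [DecidableEq ι]
    (U : ι → Fin 4 → Matrix (Fin 2) (Fin 2) ℂ) :
    kron (fun i => ∑ b, U i b) = ∑ Q : ι → Fin 4, kron (fun i => U i (Q i)) := by
  ext x y
  simp only [kron, Matrix.of_apply, Matrix.sum_apply, Fintype.prod_sum]

theorem pauliMat_conjTranspose (a : Fin 4) : (pauliMat a)ᴴ = pauliMat a := by
  fin_cases a <;> ext i j <;> fin_cases i <;> fin_cases j <;>
    simp [pauliMat, Matrix.conjTranspose_apply]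

theorem pauliMat_mul_self (a : Fin 4) : pauliMat a * pauliMat a = 1 := by
  fin_cases a <;> ext i j <;> fin_cases i <;> fin_cases j <;>
    simp [pauliMat, Matrix.mul_apply, Fin.sum_univ_two]

theorem trace_pauliMat_mul (a b : Fin 4) :
    (pauliMat a * pauliMat b).trace = if a = b then 2 else 0 := by
  fin_cases a <;> fin_cases b <;>
    norm_num [pauliMat, Matrix.trace, Matrix.mul_apply, Fin.sum_univ_two]

theorem pauliMat_completeness (x y z w : Fin 2) :
    ∑ a, pauliMat a x y * star (pauliMat a z w) = if x = z ∧ y = w then 2 else 0 := by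
  have h2 : pauliMat 2 = !![0, -Complex.I; Complex.I, 0] := rfl
  have h3 : pauliMat 3 = !![1, 0; 0, -1] := rfl
  fin_cases x <;> fin_cases y <;> fin_cases z <;> fin_cases w <;>
    simp [Fin.sum_univ_four, h2, h3] <;> norm_num [pauliMat]

theorem eq_sum_pauliMat (A : Matrix (Fin 2) (Fin 2) ℂ) :
    A = ∑ b, (2⁻¹ * (A * pauliMat b).trace) • pauliMat b := by
  ext i j
  fin_cases i <;> fin_cases j <;>
    simp [pauliMat, Fin.sum_univ_four, Matrix.trace, Matrix.mul_apply, Fin.sum_univ_two] <;>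
    ring_nf <;> simp <;> ring

/-- The label of the product of two Pauli matrices. -/
def labelMul : Fin 4 → Fin 4 → Fin 4 :=
  ![![0, 1, 2, 3], ![1, 0, 3, 2], ![2, 3, 0, 1], ![3, 2, 1, 0]]

theorem exists_pauliMat_mul (a b : Fin 4) :
    ∃ c : ℂ, c ≠ 0 ∧ pauliMat a * pauliMat b = c • pauliMat (labelMul a b) := by
  have h : (pauliMat a * pauliMat b = (1 : ℂ) • pauliMat (labelMul a b)) ∨
      (pauliMat a * pauliMat b = Complex.I • pauliMat (labelMul a b)) ∨
      (pauliMat a * pauliMat b = (-Complex.I) • pauliMat (labelMul a b)) := by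
    fin_cases a <;> fin_cases b <;>
      simp [pauliMat, labelMul, ← Matrix.one_fin_two]
  rcases h with h | h | h
  exacts [⟨_, one_ne_zero, h⟩, ⟨_, Complex.I_ne_zero, h⟩, ⟨_, neg_ne_zero.2 Complex.I_ne_zero, h⟩]

/-- The tensor product of Pauli matrices with the given labels. -/
noncomputable def pauliString {ι : Type} [Fintype ι] (P : ι → Fin 4) :
    Matrix (ι → Fin 2) (ι → Fin 2) ℂ :=
  kron fun i => pauliMat (P i)

/-- The expectation value of a Pauli string in a pure state. -/
noncomputable def pauliExp {ι : Type} [Fintype ι] [DecidableEq ι] (ψ : (ι → Fin 2) → ℂ)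
    (P : ι → Fin 4) : ℂ :=
  star ψ ⬝ᵥ (pauliString P *ᵥ ψ)

theorem pauliString_completeness {ι : Type} [Fintype ι] [DecidableEq ι] (x y z w : ι → Fin 2) :
    ∑ P : ι → Fin 4, pauliString P x y * star (pauliString P z w) =
      if x = z ∧ y = w then 2 ^ Fintype.card ι else 0 := by
  simp only [pauliString, kron, Matrix.of_apply, star_prod, ← Finset.prod_mul_distrib]
  rw [← Fintype.prod_sum (fun i a => pauliMat a (x i) (y i) * star (pauliMat a (z i) (w i)))]
  simp only [pauliMat_completeness, Finset.prod_ite_zero, funext_iff, ← forall_and]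
  simp

theorem sum_pauliExp_mul_star {ι : Type} [Fintype ι] [DecidableEq ι] (ψ φ : (ι → Fin 2) → ℂ) :
    ∑ P, pauliExp ψ P * star (pauliExp φ P) =
      2 ^ Fintype.card ι * ((star ψ ⬝ᵥ φ) * star (star ψ ⬝ᵥ φ)) := by
  have expand : ∀ (χ : (ι → Fin 2) → ℂ) (P : ι → Fin 4), pauliExp χ P =
      ∑ p : (ι → Fin 2) × (ι → Fin 2), star (χ p.1) * χ p.2 * pauliString P p.1 p.2 := by
    intro χ P
    simp only [pauliExp, dotProduct, Matrix.mulVec, Pi.star_apply, Finset.mul_sum,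
      Fintype.sum_prod_type]
    exact Finset.sum_congr rfl fun x _ => Finset.sum_congr rfl fun y _ => by ring
  have term : ∀ P, pauliExp ψ P * star (pauliExp φ P) =
      ∑ p : (ι → Fin 2) × (ι → Fin 2), ∑ q : (ι → Fin 2) × (ι → Fin 2),
        star (ψ p.1) * ψ p.2 * (φ q.1 * star (φ q.2)) *
          (pauliString P p.1 p.2 * star (pauliString P q.1 q.2)) := by
    intro P
    rw [expand, expand, star_sum, Finset.sum_mul_sum]
    refine Finset.sum_congr rfl fun p _ => Finset.sum_congr rfl fun q _ => ?_
    simp only [star_mul', star_star]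
    ring
  simp only [term]
  rw [Finset.sum_comm]
  simp only [Finset.sum_comm (s := (Finset.univ : Finset (ι → Fin 4))), ← Finset.mul_sum,
    pauliString_completeness, ← Prod.ext_iff, mul_ite, mul_zero, Finset.sum_ite_eq,
    Finset.mem_univ, if_true]
  simp only [dotProduct, Pi.star_apply, star_sum, star_mul', star_star]
  rw [Finset.sum_mul_sum]
  simp only [Finset.mul_sum, Fintype.sum_prod_type]
  exact Finset.sum_congr rfl fun x _ => Finset.sum_congr rfl fun y _ => by ring

theorem pauliExp_zero {ι : Type} [Fintype ι] [DecidableEq ι] (ψ : (ι → Fin 2) → ℂ) :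
    pauliExp ψ 0 = star ψ ⬝ᵥ ψ := by
  have : pauliString (0 : ι → Fin 4) = 1 := kron_one
  rw [pauliExp, this, Matrix.one_mulVec]

/-- The coefficients of the conjugated Pauli matrices `Uᴴ σ_a U` in the Pauli basis. -/
noncomputable def pauliRot (U : Matrix (Fin 2) (Fin 2) ℂ) : Matrix (Fin 4) (Fin 4) ℝ :=
  Matrix.of fun a b => (2⁻¹ * (Uᴴ * pauliMat a * U * pauliMat b).trace).re

theorem coe_pauliRot (U : Matrix (Fin 2) (Fin 2) ℂ) (a b : Fin 4) :
    (pauliRot U a b : ℂ) = 2⁻¹ * (Uᴴ * pauliMat a * U * pauliMat b).trace := by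
  refine Complex.conj_eq_iff_re.1 ?_
  have h : star (Uᴴ * pauliMat a * U * pauliMat b).trace =
      (Uᴴ * pauliMat a * U * pauliMat b).trace := by
    rw [← Matrix.trace_conjTranspose]
    simp only [Matrix.conjTranspose_mul, pauliMat_conjTranspose, Matrix.conjTranspose_conjTranspose]
    rw [Matrix.trace_mul_comm]
    simp only [Matrix.mul_assoc]
  rw [map_mul, starRingEnd_apply, starRingEnd_apply, h]
  simp

theorem conj_pauliMat (U : Matrix (Fin 2) (Fin 2) ℂ) (a : Fin 4) :
    Uᴴ * pauliMat a * U = ∑ b, (pauliRot U a b : ℂ) • pauliMat b := by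
  simp only [coe_pauliRot]
  exact eq_sum_pauliMat _

theorem pauliRot_mul_transpose {U : Matrix (Fin 2) (Fin 2) ℂ}
    (hU : U ∈ Matrix.unitaryGroup (Fin 2) ℂ) : pauliRot U * (pauliRot U)ᵀ = 1 := by
  have hU' : U * Uᴴ = 1 := Matrix.mem_unitaryGroup_iff.1 hU
  ext a c
  rw [Matrix.mul_apply, Matrix.one_apply]
  have h1 : ((Uᴴ * pauliMat a * U) * (Uᴴ * pauliMat c * U)).trace = if a = c then 2 else 0 := by
    rw [← trace_pauliMat_mul, show (Uᴴ * pauliMat a * U) * (Uᴴ * pauliMat c * U) =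
      Uᴴ * (pauliMat a * (U * Uᴴ) * pauliMat c * U) by simp only [Matrix.mul_assoc],
      Matrix.trace_mul_comm, hU', Matrix.mul_one, Matrix.mul_assoc _ U, hU', Matrix.mul_one]
  rw [conj_pauliMat U a, conj_pauliMat U c] at h1
  simp only [Finset.sum_mul_sum, Matrix.trace_sum, Matrix.smul_mul, Matrix.mul_smul,
    Matrix.trace_smul, trace_pauliMat_mul, smul_eq_mul, mul_ite, mul_zero, Finset.sum_ite_eq,
    Finset.mem_univ, if_true] at h1
  have h2 : ((∑ b, pauliRot U a b * (pauliRot U)ᵀ b c : ℝ) : ℂ) = if a = c then 1 else 0 := by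
    have : (2 : ℂ) * ((∑ b, pauliRot U a b * (pauliRot U)ᵀ b c : ℝ) : ℂ) =
        2 * if a = c then 1 else 0 := by
      rw [mul_ite, mul_one, mul_zero, ← h1]
      push_cast
      rw [Finset.mul_sum]
      refine Finset.sum_congr rfl fun b _ => ?_
      simp only [Matrix.transpose_apply]
      ring
    exact mul_left_cancel₀ two_ne_zero this
  split_ifs at h2 ⊢ <;> exact_mod_cast h2

theorem pauliRot_zero_left {U : Matrix (Fin 2) (Fin 2) ℂ}
    (hU : U ∈ Matrix.unitaryGroup (Fin 2) ℂ) {b : Fin 4} (hb : b ≠ 0) : pauliRot U 0 b = 0 := by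
  have hU' : Uᴴ * U = 1 := Matrix.mem_unitaryGroup_iff'.1 hU
  have h0 : pauliMat 0 = 1 := rfl
  have h1 := trace_pauliMat_mul 0 b
  have h2 := coe_pauliRot U 0 b
  rw [h0, Matrix.mul_one, hU', ← h0, h1, if_neg hb.symm, mul_zero] at h2
  exact_mod_cast h2

theorem pauliRot_zero_right {U : Matrix (Fin 2) (Fin 2) ℂ}
    (hU : U ∈ Matrix.unitaryGroup (Fin 2) ℂ) {a : Fin 4} (ha : a ≠ 0) : pauliRot U a 0 = 0 := by
  have hU' : U * Uᴴ = 1 := Matrix.mem_unitaryGroup_iff.1 hU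
  have h0 : pauliMat 0 = 1 := rfl
  have h1 := trace_pauliMat_mul a 0
  have h2 := coe_pauliRot U a 0
  rw [h0, Matrix.mul_one] at h1
  rw [h0, Matrix.mul_one, Matrix.mul_assoc, Matrix.trace_mul_comm, Matrix.mul_assoc, hU',
    Matrix.mul_one, h1, if_neg ha, mul_zero] at h2
  exact_mod_cast h2

theorem pauliExp_kron_mulVec {ι : Type} [Fintype ι] [DecidableEq ι]
    (U : ι → Matrix (Fin 2) (Fin 2) ℂ) (ψ : (ι → Fin 2) → ℂ) (P : ι → Fin 4) :
    pauliExp (kron U *ᵥ ψ) P =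
      ∑ Q, ((∏ i, pauliRot (U i) (P i) (Q i) : ℝ) : ℂ) * pauliExp ψ Q := by
  have h : (kron U)ᴴ * pauliString P * kron U =
      ∑ Q, ((∏ i, pauliRot (U i) (P i) (Q i) : ℝ) : ℂ) • pauliString Q := by
    simp only [kron_conjTranspose, pauliString, kron_mul, conj_pauliMat, kron_sum, kron_smul]
    push_cast
    rfl
  have h' : pauliExp (kron U *ᵥ ψ) P =
      star ψ ⬝ᵥ (((kron U)ᴴ * pauliString P * kron U) *ᵥ ψ) := by
    rw [pauliExp, Matrix.star_mulVec, ← Matrix.dotProduct_mulVec, Matrix.mulVec_mulVec,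
      Matrix.mulVec_mulVec, Matrix.mul_assoc]
  rw [h', h, Matrix.sum_mulVec, dotProduct_sum]
  simp only [Matrix.smul_mulVec, dotProduct_smul, smul_eq_mul, pauliExp]

/-- The Pauli strings occurring, up to phase, in a stabilizer. -/
def Stabilizer.labels {ι : Type} [Fintype ι] [DecidableEq ι] (S : Stabilizer ι) :
    Set (ι → Fin 4) :=
  {P | ∃ M ∈ S.elems, M.label = P}

theorem PauliOp.phase_mul_star {ι : Type} (M : PauliOp ι) : M.phase * star M.phase = 1 := by
  rcases M.phase_ok with h | h | h | h <;> simp [h]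

section StabilizerState

variable {ι : Type} [Fintype ι] [DecidableEq ι] {S : Stabilizer ι} {ψ : (ι → Fin 2) → ℂ}

theorem stabilizesState.dotProduct_self (hψ : stabilizesState S ψ) : star ψ ⬝ᵥ ψ = 1 := by
  have h := congrArg (fun r : ℝ => (r : ℂ)) hψ.1
  simp only [Complex.ofReal_sum, Complex.ofReal_one] at h
  rw [← h]
  refine Finset.sum_congr rfl fun x _ => ?_
  rw [Complex.normSq_eq_conj_mul_self]
  rfl

theorem stabilizesState.ne_zero (hψ : stabilizesState S ψ) : ψ ≠ 0 := by
  rintro rfl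
  simpa using hψ.dotProduct_self

theorem stabilizesState.phase_smul (hψ : stabilizesState S ψ) {M : PauliOp ι}
    (hM : M ∈ S.elems) : M.phase • (pauliString M.label *ᵥ ψ) = ψ := by
  rw [← Matrix.smul_mulVec]
  exact hψ.2 M hM

theorem stabilizesState.pauliString_mulVec (hψ : stabilizesState S ψ) {P : ι → Fin 4}
    (hP : P ∈ S.labels) : ∃ α : ℂ, α * star α = 1 ∧ pauliString P *ᵥ ψ = α • ψ := by
  obtain ⟨M, hM, rfl⟩ := hP
  refine ⟨star M.phase, by rw [star_star, mul_comm, M.phase_mul_star], ?_⟩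
  nth_rewrite 2 [← hψ.phase_smul hM]
  rw [smul_smul, mul_comm, M.phase_mul_star, one_smul]

theorem stabilizesState.label_injOn (hψ : stabilizesState S ψ) :
    Set.InjOn PauliOp.label (S.elems : Set (PauliOp ι)) := by
  intro M hM N hN h
  have h1 := hψ.phase_smul hM
  have h2 := hψ.phase_smul hN
  rw [← h] at h2
  have h3 : (M.phase - N.phase) • (pauliString M.label *ᵥ ψ) = 0 := by
    rw [sub_smul, h1, h2, sub_self]
  have h4 : pauliString M.label *ᵥ ψ ≠ 0 := by
    intro h0
    rw [h0, smul_zero] at h1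
    exact hψ.ne_zero h1.symm
  have h5 : M.phase = N.phase := sub_eq_zero.1 ((smul_eq_zero.1 h3).resolve_right h4)
  cases M
  cases N
  simp_all

theorem stabilizesState.norm_pauliExp (hψ : stabilizesState S ψ) {P : ι → Fin 4}
    (hP : P ∈ S.labels) : pauliExp ψ P * star (pauliExp ψ P) = 1 := by
  obtain ⟨α, hα, h⟩ := hψ.pauliString_mulVec hP
  rw [pauliExp, h, dotProduct_smul, hψ.dotProduct_self, smul_eq_mul, mul_one, hα]

theorem stabilizesState.pauliExp_eq_zero (hψ : stabilizesState S ψ) {P : ι → Fin 4}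
    (hP : P ∉ S.labels) : pauliExp ψ P = 0 := by
  classical
  have h := sum_pauliExp_mul_star ψ ψ
  rw [hψ.dotProduct_self, star_one, mul_one, mul_one] at h
  have h' : ∑ P, Complex.normSq (pauliExp ψ P) = 2 ^ Fintype.card ι := by
    have : ((∑ P, Complex.normSq (pauliExp ψ P) : ℝ) : ℂ) = ((2 ^ Fintype.card ι : ℝ) : ℂ) := by
      push_cast
      rw [← h]
      exact Finset.sum_congr rfl fun Q _ => (Complex.mul_conj _).symm
    exact_mod_cast this
  have hone : ∀ Q ∈ S.elems.image PauliOp.label, Complex.normSq (pauliExp ψ Q) = 1 := by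
    intro Q hQ
    obtain ⟨M, hM, rfl⟩ := Finset.mem_image.1 hQ
    have := hψ.norm_pauliExp ⟨M, hM, rfl⟩
    rw [← starRingEnd_apply, Complex.mul_conj] at this
    exact_mod_cast this
  have hsum : ∑ Q ∈ S.elems.image PauliOp.label, Complex.normSq (pauliExp ψ Q) =
      2 ^ Fintype.card ι := by
    rw [Finset.sum_congr rfl hone, Finset.sum_const, Finset.card_image_of_injOn hψ.label_injOn,
      S.card_elems]
    simp
  have hP' : P ∈ Finset.univ \ S.elems.image PauliOp.label := by
    simpa [Stabilizer.labels] using hP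
  have hrest := Finset.sum_sdiff (f := fun Q => Complex.normSq (pauliExp ψ Q))
    (Finset.subset_univ (S.elems.image PauliOp.label))
  rw [hsum, h'] at hrest
  have := (Finset.sum_eq_zero_iff_of_nonneg (fun Q _ => Complex.normSq_nonneg _)).1
    (left_eq_add.1 (by linarith : (0 : ℝ) = 0 + ∑ Q ∈ Finset.univ \ S.elems.image PauliOp.label,
      Complex.normSq (pauliExp ψ Q))) P hP'
  exact Complex.normSq_eq_zero.1 this

theorem stabilizesState.mem_labels_iff (hψ : stabilizesState S ψ) {P : ι → Fin 4} :
    P ∈ S.labels ↔ pauliExp ψ P ≠ 0 :=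
  ⟨fun h => left_ne_zero_of_mul_eq_one (hψ.norm_pauliExp h),
    fun h => by_contra fun h' => h (hψ.pauliExp_eq_zero h')⟩

theorem pauliString_mul (P Q : ι → Fin 4) :
    ∃ c : ℂ, c ≠ 0 ∧
      pauliString P * pauliString Q = c • pauliString fun i => labelMul (P i) (Q i) := by
  choose c hc h using exists_pauliMat_mul
  refine ⟨∏ i, c (P i) (Q i), Finset.prod_ne_zero_iff.2 fun i _ => hc _ _, ?_⟩
  simp only [pauliString, kron_mul, h, kron_smul]

theorem stabilizesState.labelMul_mem (hψ : stabilizesState S ψ) {P Q : ι → Fin 4}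
    (hP : P ∈ S.labels) (hQ : Q ∈ S.labels) : (fun i => labelMul (P i) (Q i)) ∈ S.labels := by
  obtain ⟨α, hα, hPψ⟩ := hψ.pauliString_mulVec hP
  obtain ⟨β, hβ, hQψ⟩ := hψ.pauliString_mulVec hQ
  obtain ⟨c, hc, hPQ⟩ := pauliString_mul P Q
  rw [hψ.mem_labels_iff]
  intro h0
  have h1 : star ψ ⬝ᵥ ((pauliString P * pauliString Q) *ᵥ ψ) = 0 := by
    rw [hPQ, Matrix.smul_mulVec, dotProduct_smul]
    exact smul_eq_zero_of_right _ h0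
  rw [← Matrix.mulVec_mulVec, hQψ, Matrix.mulVec_smul, hPψ, smul_smul, dotProduct_smul,
    hψ.dotProduct_self, smul_eq_mul, mul_one] at h1
  exact mul_ne_zero (left_ne_zero_of_mul_eq_one hβ) (left_ne_zero_of_mul_eq_one hα) h1

theorem stabilizesState.zero_mem_labels (hψ : stabilizesState S ψ) :
    (0 : ι → Fin 4) ∈ S.labels := by
  rw [hψ.mem_labels_iff, pauliExp_zero, hψ.dotProduct_self]
  exact one_ne_zero

/-- The stabilizer of a state acts nontrivially on every qubit. -/
theorem stabilizesState.exists_label_ne_zero (hψ : stabilizesState S ψ) (i : ι) :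
    ∃ P ∈ S.labels, P i ≠ 0 := by
  by_contra! hcon
  set Z : ι → Fin 4 := Pi.single i 3 with hZ
  have hZi : Z i ≠ 0 := by simp [hZ]
  have hZmem : Z ∉ S.labels := fun h => hZi (hcon Z h)
  have hZZ : (pauliString Z)ᴴ = pauliString Z := by
    simp only [pauliString, kron_conjTranspose, pauliMat_conjTranspose]
  have hcomm : ∀ P : ι → Fin 4, P i = 0 →
      pauliExp (pauliString Z *ᵥ ψ) P = pauliExp ψ P := by
    intro P hP
    have : pauliString Z * pauliString P * pauliString Z = pauliString P := by
      simp only [pauliString, kron_mul]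
      congr 1
      funext j
      by_cases hj : j = i
      · subst hj
        rw [hP, show pauliMat 0 = 1 from rfl, Matrix.mul_one, pauliMat_mul_self]
      · rw [hZ, Pi.single_eq_of_ne hj, show pauliMat 0 = 1 from rfl, Matrix.mul_one,
          Matrix.one_mul]
    rw [pauliExp, Matrix.star_mulVec, hZZ, ← Matrix.dotProduct_mulVec, Matrix.mulVec_mulVec,
      Matrix.mulVec_mulVec, this, pauliExp]
  have h1 := sum_pauliExp_mul_star ψ ψ
  have h2 := sum_pauliExp_mul_star ψ (pauliString Z *ᵥ ψ)
  have h3 : ∀ P, pauliExp ψ P * star (pauliExp (pauliString Z *ᵥ ψ) P) =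
      pauliExp ψ P * star (pauliExp ψ P) := by
    intro P
    by_cases hP : P ∈ S.labels
    · rw [hcomm P (hcon P hP)]
    · rw [hψ.pauliExp_eq_zero hP, zero_mul, zero_mul]
  have h4 : star ψ ⬝ᵥ (pauliString Z *ᵥ ψ) = 0 := hψ.pauliExp_eq_zero hZmem
  rw [Finset.sum_congr rfl fun P _ => h3 P, h1, h4, hψ.dotProduct_self] at h2
  simp at h2

end StabilizerState

theorem Submodule.exists_minimal_support {K ι : Type*} [Field K] [Fintype ι]
    (C : Submodule K (ι → K)) {i : ι} (h : ∃ c ∈ C, c i ≠ 0) :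
    ∃ c ∈ C, c i ≠ 0 ∧ ∀ d ∈ C, (∀ k, c k = 0 → d k = 0) → ∃ a : K, d = a • c := by
  classical
  obtain ⟨c, ⟨hc, hci⟩, hmin⟩ := (measure fun c : ι → K =>
    (Finset.univ.filter fun k => c k ≠ 0).card).wf.has_min {c | c ∈ C ∧ c i ≠ 0} h
  refine ⟨c, hc, hci, fun d hd hdc => ⟨d i / c i, ?_⟩⟩
  by_contra hne
  set e := d - (d i / c i) • c with he
  have heC : e ∈ C := C.sub_mem hd (C.smul_mem _ hc)
  have hei : e i = 0 := by simp [he, hci]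
  have hec : ∀ k, c k = 0 → e k = 0 := fun k hk => by simp [he, hk, hdc k hk]
  obtain ⟨j, hj⟩ : ∃ j, e j ≠ 0 := Function.ne_iff.1 (sub_ne_zero.2 hne)
  refine hmin (c - (c j / e j) • e)
    ⟨C.sub_mem hc (C.smul_mem _ heC), by simpa [hei] using hci⟩ ?_
  refine Finset.card_lt_card ((Finset.ssubset_iff_of_subset fun k => ?_).2 ⟨j, ?_, ?_⟩)
  · simp only [Finset.mem_filter, Finset.mem_univ, true_and]
    intro hk hck
    exact hk (by simp [hck, hec k hck])
  · simpa using fun hcj => hj (hec j hcj)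
  · simp [hj]

theorem exists_sq_eq_add_one : ∃ ξ : GaloisField 2 2, ξ ^ 2 = ξ + 1 := by
  classical
  have hcard : Nat.card (GaloisField 2 2) = 4 := GaloisField.card 2 2 two_ne_zero
  have : Fintype (GaloisField 2 2) := Fintype.ofFinite _
  rw [Nat.card_eq_fintype_card] at hcard
  obtain ⟨ξ, hξ⟩ : ∃ ξ : GaloisField 2 2, ξ ∉ ({0, 1} : Finset (GaloisField 2 2)) := by
    by_contra! h
    have h1 : (Finset.univ : Finset (GaloisField 2 2)).card ≤
        ({0, 1} : Finset (GaloisField 2 2)).card := Finset.card_le_card fun x _ => h x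
    have h2 := Finset.card_le_two (a := (0 : GaloisField 2 2)) (b := 1)
    rw [Finset.card_univ, hcard] at h1
    omega
  simp only [Finset.mem_insert, Finset.mem_singleton, not_or] at hξ
  have h4 := FiniteField.pow_card ξ
  rw [hcard] at h4
  refine ⟨ξ, ?_⟩
  have h5 : ξ * (ξ - 1) * (ξ ^ 2 + ξ + 1) = 0 := by linear_combination h4
  have h6 := (mul_eq_zero.1 h5).resolve_left (mul_ne_zero hξ.1 (sub_ne_zero.2 hξ.2))
  have h7 : (2 : GaloisField 2 2) = 0 := CharP.cast_eq_zero (GaloisField 2 2) 2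
  linear_combination h6 - (ξ + 1) * h7

theorem pauliToGF4_labelMul {ξ : GaloisField 2 2} (hξ : ξ ^ 2 = ξ + 1) (a b : Fin 4) :
    pauliToGF4 ξ (labelMul a b) = pauliToGF4 ξ a + pauliToGF4 ξ b := by
  have h2 : (2 : GaloisField 2 2) = 0 := CharP.cast_eq_zero (GaloisField 2 2) 2
  fin_cases a <;> fin_cases b <;> simp [pauliToGF4, labelMul] <;> grind

theorem pauliToGF4_bijective {ξ : GaloisField 2 2} (hξ : ξ ^ 2 = ξ + 1) :
    Function.Bijective (pauliToGF4 ξ) := by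
  have h2 : (2 : GaloisField 2 2) = 0 := CharP.cast_eq_zero (GaloisField 2 2) 2
  have h0 : ξ ≠ 0 := by rintro rfl; simp at hξ
  have h1 : ξ ≠ 1 := by rintro rfl; simp at hξ
  refine Function.Injective.bijective_of_nat_card_le ?_ ?_
  · intro a b
    fin_cases a <;> fin_cases b <;> simp [pauliToGF4] <;> grind
  · rw [GaloisField.card 2 2 two_ne_zero]
    simp

/-- In the stabilizer of a linear code, every qubit lies in a set `ω` such that the elements
supported in `ω` are determined by their label at any single qubit of `ω`. -/
theorem stabilizesState.exists_minimal_support {n : ℕ} {S : Stabilizer (Fin n)}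
    {ψ : (Fin n → Fin 2) → ℂ} (hψ : stabilizesState S ψ)
    (hlin : ∀ ξ : GaloisField 2 2, ξ ^ 2 = ξ + 1 →
      ∀ c ∈ gf4Code ξ S, (fun i => ξ * c i) ∈ gf4Code ξ S) (i : Fin n) :
    ∃ ω : Finset (Fin n), i ∈ ω ∧
      (∀ P ∈ S.labels, ∀ Q ∈ S.labels, (∀ k ∉ ω, P k = 0) → (∀ k ∉ ω, Q k = 0) →
        ∀ j ∈ ω, P j = Q j → P = Q) ∧
      ∀ b, ∃ Q ∈ S.labels, (∀ k ∉ ω, Q k = 0) ∧ Q i = b := by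
  classical
  obtain ⟨ξ, hξ⟩ := exists_sq_eq_add_one
  have hbij := pauliToGF4_bijective hξ
  have hzero : pauliToGF4 ξ 0 = 0 := rfl
  have hmem : ∀ P : Fin n → Fin 4, (fun k => pauliToGF4 ξ (P k)) ∈ gf4Code ξ S ↔
      P ∈ S.labels := by
    refine fun P => ⟨?_, ?_⟩
    · rintro ⟨M, hM, h⟩
      exact ⟨M, hM, funext fun k => (hbij.1 (h k)).symm⟩
    · rintro ⟨M, hM, rfl⟩
      exact ⟨M, hM, fun k => rfl⟩
  have hrep : ∀ c : Fin n → GaloisField 2 2, ∃ P : Fin n → Fin 4, c = fun k => pauliToGF4 ξ (P k) := by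
    intro c
    choose P hP using fun k => hbij.2 (c k)
    exact ⟨P, funext fun k => (hP k).symm⟩
  have hzeroC : (0 : Fin n → GaloisField 2 2) ∈ gf4Code ξ S :=
    (hmem 0).2 hψ.zero_mem_labels
  let C : Submodule (GaloisField 2 2) (Fin n → GaloisField 2 2) :=
    { carrier := gf4Code ξ S
      zero_mem' := hzeroC
      add_mem' := by
        intro c d hc hd
        obtain ⟨P, rfl⟩ := hrep c
        obtain ⟨Q, rfl⟩ := hrep d
        have := (hmem _).2 (hψ.labelMul_mem ((hmem P).1 hc) ((hmem Q).1 hd))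
        simp only [pauliToGF4_labelMul hξ] at this
        exact this
      smul_mem' := by
        intro a c hc
        have hc' := hlin ξ hξ c hc
        obtain ⟨b, rfl⟩ := hbij.2 a
        fin_cases b
        · convert hzeroC
          exact zero_smul _ c
        · exact hc'
        · convert hlin ξ hξ _ hc' using 1
          funext k
          simp only [Pi.smul_apply, smul_eq_mul, ← mul_assoc, ← sq]
          rfl
        · convert hc
          exact one_smul _ c }
  have hC : ∀ P : Fin n → Fin 4, (fun k => pauliToGF4 ξ (P k)) ∈ C ↔ P ∈ S.labels := hmem
  obtain ⟨P, hP, hPi⟩ := hψ.exists_label_ne_zero i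
  obtain ⟨c, hc, hci, hmin⟩ := C.exists_minimal_support (i := i)
    ⟨_, (hC P).2 hP, fun h => hPi (hbij.1 h)⟩
  have hsub : ∀ Q : Fin n → Fin 4, Q ∈ S.labels →
      (∀ k ∉ Finset.univ.filter fun k => c k ≠ 0, Q k = 0) →
      ∃ a : GaloisField 2 2, ∀ k, pauliToGF4 ξ (Q k) = a * c k := by
    intro Q hQ h
    obtain ⟨a, ha⟩ := hmin _ ((hC Q).2 hQ) fun k hk => by
      rw [h k (by simpa using hk), hzero]
    exact ⟨a, fun k => congrFun ha k⟩
  refine ⟨Finset.univ.filter fun k => c k ≠ 0, by simpa using hci, ?_, ?_⟩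
  · intro P hP Q hQ hPω hQω j hj hPQ
    obtain ⟨a, ha⟩ := hsub P hP hPω
    obtain ⟨b, hb⟩ := hsub Q hQ hQω
    have hab : a = b := by
      refine mul_right_cancel₀ (b := c j) (by simpa using hj) ?_
      rw [← ha, ← hb, hPQ]
    exact funext fun k => hbij.1 (by rw [ha, hb, hab])
  · intro b
    obtain ⟨Q, hQ⟩ := hrep ((pauliToGF4 ξ b / c i) • c)
    refine ⟨Q, (hC Q).1 (hQ ▸ C.smul_mem _ hc), fun k hk => hbij.1 ?_, hbij.1 ?_⟩
    · have hk' : c k = 0 := by simpa using hk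
      rw [← congrFun hQ k, hzero, Pi.smul_apply, hk', smul_zero]
    · rw [← congrFun hQ i, Pi.smul_apply, smul_eq_mul, div_mul_cancel₀ _ hci]

theorem sum_pauliRot_sq {U : Matrix (Fin 2) (Fin 2) ℂ}
    (hU : U ∈ Matrix.unitaryGroup (Fin 2) ℂ) (a : Fin 4) : ∑ b, pauliRot U a b ^ 2 = 1 := by
  have h := congrFun (congrFun (pauliRot_mul_transpose hU) a) a
  simpa [Matrix.mul_apply, ← sq] using h

theorem abs_pauliRot_le_one {U : Matrix (Fin 2) (Fin 2) ℂ}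
    (hU : U ∈ Matrix.unitaryGroup (Fin 2) ℂ) (a b : Fin 4) : |pauliRot U a b| ≤ 1 := by
  rw [← sq_le_one_iff_abs_le_one, ← sum_pauliRot_sq hU a]
  exact Finset.single_le_sum (f := fun b => pauliRot U a b ^ 2) (fun b _ => sq_nonneg _)
    (Finset.mem_univ b)

theorem sum_pauliRot_mul_pauliRot {U : Matrix (Fin 2) (Fin 2) ℂ}
    (hU : U ∈ Matrix.unitaryGroup (Fin 2) ℂ) (b c : Fin 4) :
    ∑ a, pauliRot U a b * pauliRot U a c = if b = c then 1 else 0 := by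
  have h1 : (pauliRot U)ᵀ * pauliRot U = 1 := mul_eq_one_comm.1 (pauliRot_mul_transpose hU)
  have h := congrFun (congrFun h1 b) c
  simpa [Matrix.mul_apply, Matrix.one_apply] using h

/-- A unitary whose conjugation action has an entry of modulus one for every Pauli matrix is
Clifford. -/
theorem isClifford_of_one_le_abs_pauliRot {U : Matrix (Fin 2) (Fin 2) ℂ}
    (hU : U ∈ Matrix.unitaryGroup (Fin 2) ℂ)
    (h : ∀ a, a ≠ 0 → ∃ b, 1 ≤ |pauliRot U a b|) : IsClifford U := by
  refine ⟨hU, ?_⟩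
  have hU' : U * Uᴴ = 1 := Matrix.mem_unitaryGroup_iff.1 hU
  have key : ∀ u : Fin 3, ∃ v : Fin 3, (pauliRot U u.succ v.succ) ^ 2 = 1 ∧
      ∀ c, c ≠ v.succ → pauliRot U u.succ c = 0 := by
    intro u
    obtain ⟨b, hb⟩ := h u.succ (Fin.succ_ne_zero u)
    have hb0 : b ≠ 0 := by
      rintro rfl
      rw [pauliRot_zero_right hU (Fin.succ_ne_zero u)] at hb
      norm_num at hb
    obtain ⟨v, rfl⟩ := Fin.exists_succ_eq.2 hb0
    have h1 : pauliRot U u.succ v.succ ^ 2 = 1 := by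
      rw [← sq_abs, le_antisymm (abs_pauliRot_le_one hU _ _) hb, one_pow]
    refine ⟨v, h1, fun c hc => ?_⟩
    have h2 := sum_pauliRot_sq hU u.succ
    rw [← Finset.add_sum_erase _ _ (Finset.mem_univ v.succ), h1, add_eq_left,
      Finset.sum_eq_zero_iff_of_nonneg fun _ _ => sq_nonneg _] at h2
    exact pow_eq_zero_iff two_ne_zero |>.1 (h2 c (Finset.mem_erase.2 ⟨hc, Finset.mem_univ c⟩))
  choose f hf hf0 using key
  have hinj : Function.Injective f := by
    intro u v huv
    by_contra hne
    have h2 := congrFun (congrFun (pauliRot_mul_transpose hU) u.succ) v.succ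
    rw [Matrix.mul_apply, Matrix.one_apply_ne ((Fin.succ_injective 3).ne hne),
      Finset.sum_eq_single (f u).succ (fun c _ hc => by rw [hf0 u c hc, zero_mul]) (by simp),
      Matrix.transpose_apply, mul_eq_zero] at h2
    have hu := hf u
    have hv := hf v
    rw [← huv] at hv
    rcases h2 with h2 | h2 <;> simp [h2] at hu hv
  let g : Equiv.Perm (Fin 3) := Equiv.ofBijective f (Finite.injective_iff_bijective.1 hinj)
  refine ⟨g.symm, fun v => ?_⟩
  obtain ⟨u, rfl⟩ := g.surjective v
  rw [g.symm_apply_apply]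
  have hs : pauliRot U u.succ (f u).succ = 1 ∨ pauliRot U u.succ (f u).succ = -1 :=
    mul_self_eq_one_iff.1 (by rw [← sq, hf u])
  set s := pauliRot U u.succ (f u).succ with hsdef
  refine ⟨(s : ℂ), by rcases hs with hs | hs <;> simp [hs], ?_⟩
  have h3 := conj_pauliMat U u.succ
  rw [Finset.sum_eq_single (f u).succ (fun c _ hc => by rw [hf0 u c hc]; simp) (by simp),
    ← hsdef] at h3
  have h4 : pauliMat u.succ = (s : ℂ) • (U * pauliMat (f u).succ * Uᴴ) := by
    rw [← Matrix.smul_mul, ← Matrix.mul_smul, ← h3]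
    rw [show U * (Uᴴ * pauliMat u.succ * U) * Uᴴ = (U * Uᴴ) * pauliMat u.succ * (U * Uᴴ) by
      simp only [Matrix.mul_assoc], hU', Matrix.one_mul, Matrix.mul_one]
  rw [h4, smul_smul, show (s : ℂ) * s = 1 by rw [← sq]; exact_mod_cast hf u, one_smul]
  rfl

theorem exists_one_le_of_one_le_sum_mul {κ : Type*} {K : Finset κ} {x y z : κ → ℝ}
    (hy : ∀ q, 0 ≤ y q) (hz : ∀ q, 0 ≤ z q)
    (hy2 : ∑ q ∈ K, y q ^ 2 ≤ 1) (hz2 : ∑ q ∈ K, z q ^ 2 ≤ 1)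
    (h : 1 ≤ ∑ q ∈ K, x q * y q * z q) : ∃ q ∈ K, 1 ≤ x q := by
  by_contra! hlt
  have h1 : ∀ q ∈ K, x q * y q * z q ≤ (y q ^ 2 + z q ^ 2) / 2 := by
    intro q hq
    nlinarith [sq_nonneg (y q - z q), mul_nonneg (hy q) (hz q),
      mul_le_of_le_one_left (mul_nonneg (hy q) (hz q)) (hlt q hq).le]
  have h2 : ∑ q ∈ K, (y q ^ 2 + z q ^ 2) / 2 ≤ 1 := by
    rw [← Finset.sum_div, Finset.sum_add_distrib]
    linarith
  have h3 := (Finset.sum_eq_sum_iff_of_le h1).1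
    (le_antisymm (Finset.sum_le_sum h1) (h2.trans h))
  have h4 : ∑ q ∈ K, x q * y q * z q = 0 := by
    refine Finset.sum_eq_zero fun q hq => ?_
    have h5 := h3 q hq
    have h6 : (1 - x q) * (y q * z q) ≤ 0 := by nlinarith [sq_nonneg (y q - z q)]
    have h7 : y q * z q = 0 :=
      le_antisymm (nonpos_of_mul_nonpos_right h6 (sub_pos.2 (hlt q hq)))
        (mul_nonneg (hy q) (hz q))
    rw [mul_assoc, h7, mul_zero]
  linarith

section LocalUnitary

variable {ι : Type} [Fintype ι] [DecidableEq ι]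

theorem exists_pauliExp_kron_ne_zero {S : Stabilizer ι} {ψ : (ι → Fin 2) → ℂ}
    {U : ι → Matrix (Fin 2) (Fin 2) ℂ} (hU : ∀ i, U i ∈ Matrix.unitaryGroup (Fin 2) ℂ)
    (hψ : stabilizesState S ψ) {ω : Finset ι} {i j : ι} (hi : i ∈ ω) (hj : j ∈ ω) (hij : i ≠ j)
    (hinj : ∀ P ∈ S.labels, ∀ Q ∈ S.labels, (∀ k ∉ ω, P k = 0) → (∀ k ∉ ω, Q k = 0) →
      ∀ j ∈ ω, P j = Q j → P = Q)
    (hsurj : ∀ b, ∃ Q ∈ S.labels, (∀ k ∉ ω, Q k = 0) ∧ Q i = b) (a : Fin 4) :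
    ∃ P : ι → Fin 4, P i = a ∧ (∀ k ∉ ω, P k = 0) ∧ pauliExp (kron U *ᵥ ψ) P ≠ 0 := by
  obtain ⟨b, hb⟩ : ∃ b, pauliRot (U i) a b ≠ 0 := by
    by_contra! h
    have := sum_pauliRot_sq (hU i) a
    simp [h] at this
  obtain ⟨A, hA, hAω, hAi⟩ := hsurj b
  have hsum : ∑ P : ι → Fin 4, ((∏ l, (if l = i then (if P l = a then 1 else 0) else
      pauliRot (U l) (P l) (A l)) : ℝ) : ℂ) * pauliExp (kron U *ᵥ ψ) P =
      pauliRot (U i) a b * pauliExp ψ A := by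
    simp only [pauliExp_kron_mulVec, Finset.mul_sum]
    rw [Finset.sum_comm]
    simp only [← mul_assoc, ← Finset.sum_mul, ← Complex.ofReal_mul, ← Complex.ofReal_sum,
      ← Finset.prod_mul_distrib]
    have hprod : ∀ Q : ι → Fin 4, ∑ P : ι → Fin 4, ∏ l,
        (if l = i then (if P l = a then 1 else 0) else pauliRot (U l) (P l) (A l)) *
          pauliRot (U l) (P l) (Q l) =
        ∏ l, if l = i then pauliRot (U i) a (Q i) else if A l = Q l then 1 else 0 := by
      intro Q
      rw [← Fintype.prod_sum (fun l p => (if l = i then (if p = a then 1 else 0) else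
        pauliRot (U l) p (A l)) * pauliRot (U l) p (Q l))]
      refine Finset.prod_congr rfl fun l _ => ?_
      split_ifs with hl hl'
      · subst hl
        simp
      · rw [sum_pauliRot_mul_pauliRot (hU l), if_pos hl']
      · rw [sum_pauliRot_mul_pauliRot (hU l), if_neg hl']
    simp only [hprod]
    rw [Finset.sum_eq_single A]
    · congr 2
      rw [Finset.prod_eq_single i (fun l _ hl => by simp [hl]) (by simp), if_pos rfl, hAi]
    · intro Q _ hQA
      by_cases hQ : Q ∈ S.labels
      · obtain ⟨l, hl⟩ : ∃ l, l ≠ i ∧ A l ≠ Q l := by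
          by_contra! hcon
          refine hQA (hinj Q hQ A hA (fun k hk => ?_) hAω j hj (hcon j hij.symm).symm)
          rw [← hcon k (fun h => hk (h ▸ hi)), hAω k hk]
        rw [Finset.prod_eq_zero (Finset.mem_univ l) (by rw [if_neg hl.1, if_neg hl.2])]
        simp
      · rw [hψ.pauliExp_eq_zero hQ, mul_zero]
    · simp
  have hne : (pauliRot (U i) a b : ℂ) * pauliExp ψ A ≠ 0 :=
    mul_ne_zero (by exact_mod_cast hb) (hψ.mem_labels_iff.1 hA)
  rw [← hsum] at hne
  obtain ⟨P, -, hP⟩ := Finset.exists_ne_zero_of_sum_ne_zero hne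
  have hP1 := left_ne_zero_of_mul hP
  have hP2 := Finset.prod_ne_zero_iff.1 (Complex.ofReal_ne_zero.1 hP1)
  refine ⟨P, ?_, fun l hl => ?_, right_ne_zero_of_mul hP⟩
  · have := hP2 i (Finset.mem_univ i)
    by_contra h
    simp [h] at this
  · have := hP2 l (Finset.mem_univ l)
    rw [if_neg (ne_of_mem_of_not_mem hi hl).symm, hAω l hl] at this
    by_contra h
    exact this (pauliRot_zero_right (hU l) h)

theorem stabilizesState.norm_pauliExp_eq_one {S : Stabilizer ι} {ψ : (ι → Fin 2) → ℂ}
    (hψ : stabilizesState S ψ) {P : ι → Fin 4} (hP : P ∈ S.labels) : ‖pauliExp ψ P‖ = 1 := by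
  have := hψ.norm_pauliExp hP
  rw [← starRingEnd_apply, Complex.mul_conj, Complex.normSq_eq_norm_sq] at this
  exact (pow_eq_one_iff_of_nonneg (norm_nonneg _) two_ne_zero).1 (by exact_mod_cast this)

theorem prod_le_mul_mul {f : ι → ℝ} (h0 : ∀ l, 0 ≤ f l) (h1 : ∀ l, f l ≤ 1) {i j k : ι}
    (hij : i ≠ j) (hik : i ≠ k) (hjk : j ≠ k) : ∏ l, f l ≤ f i * f j * f k := by
  rw [← Finset.prod_sdiff (Finset.subset_univ {i, j, k}),
    Finset.prod_insert (by simp [hij, hik]), Finset.prod_pair hjk, mul_assoc (f i)]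
  exact mul_le_of_le_one_left (mul_nonneg (h0 i) (mul_nonneg (h0 j) (h0 k)))
    (Finset.prod_le_one (fun l _ => h0 l) fun l _ => h1 l)

theorem exists_one_le_abs_pauliRot {S S' : Stabilizer ι} {ψ : (ι → Fin 2) → ℂ}
    {U : ι → Matrix (Fin 2) (Fin 2) ℂ} (hU : ∀ i, U i ∈ Matrix.unitaryGroup (Fin 2) ℂ)
    (hψ : stabilizesState S ψ) (hφ : stabilizesState S' (kron U *ᵥ ψ))
    {ω : Finset ι} {i j k : ι} (hi : i ∈ ω) (hj : j ∈ ω) (hk : k ∈ ω)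
    (hij : i ≠ j) (hik : i ≠ k) (hjk : j ≠ k)
    (hinj : ∀ P ∈ S.labels, ∀ Q ∈ S.labels, (∀ k ∉ ω, P k = 0) → (∀ k ∉ ω, Q k = 0) →
      ∀ j ∈ ω, P j = Q j → P = Q)
    (hsurj : ∀ b, ∃ Q ∈ S.labels, (∀ k ∉ ω, Q k = 0) ∧ Q i = b) {a : Fin 4} :
    ∃ b, 1 ≤ |pauliRot (U i) a b| := by
  classical
  obtain ⟨P, hPa, hPω, hP⟩ := exists_pauliExp_kron_ne_zero hU hψ hi hj hij hinj hsurj a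
  let K : Finset (ι → Fin 4) :=
    Finset.univ.filter fun Q => Q ∈ S.labels ∧ ∀ k ∉ ω, Q k = 0
  have hKsq : ∀ l ∈ ω, ∑ Q ∈ K, |pauliRot (U l) (P l) (Q l)| ^ 2 ≤ 1 := by
    intro l hl
    simp only [sq_abs]
    rw [← sum_pauliRot_sq (hU l) (P l),
      ← Finset.sum_image (g := fun Q : ι → Fin 4 => Q l) (s := K)
        (f := fun b => pauliRot (U l) (P l) b ^ 2)]
    · exact Finset.sum_le_sum_of_subset_of_nonneg (Finset.subset_univ _) fun _ _ _ => sq_nonneg _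
    · intro Q hQ R hR hQR
      simp only [K, Finset.coe_filter, Finset.mem_univ, true_and, Set.mem_ofPred_eq] at hQ hR
      exact hinj Q hQ.1 R hR.1 hQ.2 hR.2 l hl hQR
  have hone := hφ.norm_pauliExp_eq_one (hφ.mem_labels_iff.2 hP)
  have hbound : 1 ≤ ∑ Q ∈ K, |pauliRot (U i) (P i) (Q i)| * |pauliRot (U j) (P j) (Q j)| *
      |pauliRot (U k) (P k) (Q k)| := by
    rw [← hone, pauliExp_kron_mulVec]
    rw [← Finset.sum_subset (Finset.subset_univ K)]
    · refine (norm_sum_le _ _).trans (Finset.sum_le_sum fun Q hQ => ?_)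
      rw [norm_mul, hψ.norm_pauliExp_eq_one (Finset.mem_filter.1 hQ).2.1, mul_one, Complex.norm_real,
        Real.norm_eq_abs, Finset.abs_prod]
      exact prod_le_mul_mul (fun _ => abs_nonneg _) (fun l => abs_pauliRot_le_one (hU l) _ _)
        hij hik hjk
    · intro Q _ hQ
      by_cases hQS : Q ∈ S.labels
      · have : ¬ ∀ k ∉ ω, Q k = 0 := fun h => hQ (Finset.mem_filter.2 ⟨Finset.mem_univ Q, hQS, h⟩)
        push Not at this
        obtain ⟨l, hl, hQl⟩ := this
        rw [Finset.prod_eq_zero (Finset.mem_univ l)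
          (by rw [hPω l hl]; exact pauliRot_zero_left (hU l) hQl)]
        simp
      · rw [hψ.pauliExp_eq_zero hQS, mul_zero]
  have hnn : ∀ l (Q : ι → Fin 4), 0 ≤ |pauliRot (U l) (P l) (Q l)| := fun _ _ => abs_nonneg _
  obtain ⟨Q, -, hQ⟩ := exists_one_le_of_one_le_sum_mul (hnn j) (hnn k) (hKsq j hj) (hKsq k hk)
    hbound
  rw [← hPa]
  exact ⟨Q i, hQ⟩

end LocalUnitary

theorem eq_smul_one_of_commute {A : Matrix (Fin 2) (Fin 2) ℂ}
    (hx : pauliMat 1 * A = A * pauliMat 1) (hz : pauliMat 3 * A = A * pauliMat 3) :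
    A = A 0 0 • 1 := by
  have h1 : pauliMat 1 = !![0, 1; 1, 0] := rfl
  have h3 : pauliMat 3 = !![1, 0; 0, -1] := rfl
  rw [h1] at hx
  rw [h3] at hz
  have hx0 := congrFun (congrFun hx 0) 1
  have hz0 := congrFun (congrFun hz 0) 1
  have hz1 := congrFun (congrFun hz 1) 0
  simp [Matrix.mul_apply, Fin.sum_univ_two] at hx0 hz0 hz1
  ext p q
  fin_cases p <;> fin_cases q <;> simp <;> grind

/-- Two matrices fixed up to phase by the same maps `V ↦ σ V B`, for `σ = σₓ, σ_z` and `B`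
unitary, are proportional. -/
theorem exists_smul_eq_of_pauli_invariant {V W B C : Matrix (Fin 2) (Fin 2) ℂ} {α β : ℂ}
    (hα : α * star α = 1) (hβ : β * star β = 1) (hB : B * Bᴴ = 1) (hC : C * Cᴴ = 1)
    (hVB : pauliMat 1 * V * B = α • V) (hWB : pauliMat 1 * W * B = α • W)
    (hVC : pauliMat 3 * V * C = β • V) (hWC : pauliMat 3 * W * C = β • W) (hV : V ≠ 0) :
    ∃ s : ℂ, W = s • V := by
  have comm : ∀ {X Y D : Matrix (Fin 2) (Fin 2) ℂ} {γ : ℂ} {a : Fin 4}, γ * star γ = 1 →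
      D * Dᴴ = 1 → pauliMat a * X * D = γ • X → pauliMat a * Y * D = γ • Y →
      pauliMat a * (X * Yᴴ) = (X * Yᴴ) * pauliMat a := by
    intro X Y D γ a hγ hD hX hY
    have h1 : (pauliMat a * X * D) * (pauliMat a * Y * D)ᴴ = X * Yᴴ := by
      rw [hX, hY, Matrix.conjTranspose_smul, Matrix.smul_mul, Matrix.mul_smul, smul_smul, hγ,
        one_smul]
    have h2 : (pauliMat a * X * D) * (pauliMat a * Y * D)ᴴ =
        pauliMat a * (X * Yᴴ) * pauliMat a := by
      rw [Matrix.conjTranspose_mul, Matrix.conjTranspose_mul, pauliMat_conjTranspose,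
        show pauliMat a * X * D * (Dᴴ * (Yᴴ * pauliMat a)) =
          pauliMat a * X * (D * Dᴴ) * Yᴴ * pauliMat a by simp only [Matrix.mul_assoc], hD,
        Matrix.mul_one]
      simp only [Matrix.mul_assoc]
    rw [h1] at h2
    calc pauliMat a * (X * Yᴴ) = pauliMat a * (X * Yᴴ) * (pauliMat a * pauliMat a) := by
          rw [pauliMat_mul_self, Matrix.mul_one]
      _ = pauliMat a * (X * Yᴴ) * pauliMat a * pauliMat a := by simp only [Matrix.mul_assoc]
      _ = (X * Yᴴ) * pauliMat a := by rw [← h2]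
  have hVV := eq_smul_one_of_commute (comm hα hB hVB hVB) (comm hβ hC hVC hVC)
  have hWV := eq_smul_one_of_commute (comm hα hB hWB hVB) (comm hβ hC hWC hVC)
  set t := (V * Vᴴ) 0 0
  set s := (W * Vᴴ) 0 0
  have ht : t ≠ 0 := by
    intro ht
    rw [ht, zero_smul] at hVV
    open ComplexOrder in exact hV (Matrix.self_mul_conjTranspose_eq_zero.1 hVV)
  have hVV' : Vᴴ * V = t • 1 := by
    have h1 : (t⁻¹ • V) * Vᴴ = 1 := by
      rw [Matrix.smul_mul, hVV, smul_smul, inv_mul_cancel₀ ht, one_smul]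
    have h2 : Vᴴ * (t⁻¹ • V) = 1 := mul_eq_one_comm.1 h1
    rw [← h2, Matrix.mul_smul, smul_smul, mul_inv_cancel₀ ht, one_smul]
  refine ⟨t⁻¹ * s, ?_⟩
  have h3 : t • W = s • V := by
    calc t • W = W * (Vᴴ * V) := by rw [hVV', Matrix.mul_smul, Matrix.mul_one]
      _ = s • V := by rw [← Matrix.mul_assoc, hWV, Matrix.smul_mul, Matrix.one_mul]
  rw [mul_smul, ← h3, smul_smul, inv_mul_cancel₀ ht, one_smul]

section PairProduct

variable {ι : Type} [Fintype ι] [DecidableEq ι]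

theorem kron_mulVec_apply_of_pair {A : ι → Matrix (Fin 2) (Fin 2) ℂ} {i j : ι} (hij : i ≠ j)
    (hA : ∀ k, k ≠ i → k ≠ j → A k = 1) (ψ : (ι → Fin 2) → ℂ) (x : ι → Fin 2) :
    (kron A *ᵥ ψ) x = ∑ p, ∑ q, A i (x i) p * A j (x j) q *
      ψ (Function.update (Function.update x i p) j q) := by
  rw [← Fintype.sum_prod_type' (f := fun p q => A i (x i) p * A j (x j) q *
      ψ (Function.update (Function.update x i p) j q)), Matrix.mulVec, dotProduct]
  symm
  refine Finset.sum_of_injOn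
    (fun r : Fin 2 × Fin 2 => Function.update (Function.update x i r.1) j r.2) ?_ ?_ ?_ ?_
  · intro r _ r' _ h
    have hi := congrFun h i
    have hj := congrFun h j
    simp only [Function.update_of_ne hij, Function.update_self] at hi hj
    exact Prod.ext hi hj
  · exact fun _ _ => Finset.mem_coe.2 (Finset.mem_univ _)
  · intro y _ hy
    obtain ⟨k, hki, hkj, hk⟩ : ∃ k, k ≠ i ∧ k ≠ j ∧ x k ≠ y k := by
      by_contra! hcon
      refine hy ⟨(y i, y j), Finset.mem_coe.2 (Finset.mem_univ _), funext fun k => ?_⟩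
      by_cases hkj : k = j
      · subst hkj
        simp
      by_cases hki : k = i
      · subst hki
        simp [hkj]
      · simp [hki, hkj, hcon k hki hkj]
    rw [kron, Matrix.of_apply, Finset.prod_eq_zero (Finset.mem_univ k), zero_mul]
    rw [hA k hki hkj, Matrix.one_apply_ne hk]
  · intro r _
    rw [kron, Matrix.of_apply, ← Finset.prod_subset (Finset.subset_univ {i, j}),
      Finset.prod_pair hij, Function.update_of_ne hij, Function.update_self, Function.update_self]
    intro k _ hk
    simp only [Finset.mem_insert, Finset.mem_singleton, not_or] at hk
    rw [hA k hk.1 hk.2, Function.update_of_ne hk.2, Function.update_of_ne hk.1,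
      Matrix.one_apply_eq]

/-- A state which is an eigenvector of two Pauli strings supported on two of at least three
qubits, acting as `σₓ` and `σ_z` on the first of them, is a product state. -/
theorem not_fullyEntangled_of_pair {ψ : (ι → Fin 2) → ℂ} {i j k : ι} (hij : i ≠ j)
    (hki : k ≠ i) (hkj : k ≠ j) {P Q : ι → Fin 4} (hP : ∀ l, l ≠ i → l ≠ j → P l = 0)
    (hQ : ∀ l, l ≠ i → l ≠ j → Q l = 0) (hPi : P i = 1) (hQi : Q i = 3) {α β : ℂ}
    (hα : α * star α = 1) (hβ : β * star β = 1)
    (hPψ : pauliString P *ᵥ ψ = α • ψ) (hQψ : pauliString Q *ᵥ ψ = β • ψ) :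
    ¬ FullyEntangled ψ := by
  let V : (ι → Fin 2) → Matrix (Fin 2) (Fin 2) ℂ := fun x =>
    Matrix.of fun p q => ψ (Function.update (Function.update x i p) j q)
  have hVx : ∀ x, V x (x i) (x j) = ψ x := fun x => by simp [V]
  have hV : ∀ {R : ι → Fin 4} {γ : ℂ}, (∀ l, l ≠ i → l ≠ j → R l = 0) →
      pauliString R *ᵥ ψ = γ • ψ →
      ∀ x, pauliMat (R i) * V x * (pauliMat (R j))ᵀ = γ • V x := by
    intro R γ hR hRψ x
    ext p q
    have h := congrFun hRψ (Function.update (Function.update x i p) j q)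
    rw [pauliString, kron_mulVec_apply_of_pair hij
      (fun l hli hlj => by rw [hR l hli hlj]; rfl)] at h
    rw [Matrix.smul_apply, show V x p q = ψ (Function.update (Function.update x i p) j q) from rfl,
      ← Pi.smul_apply, ← h, Matrix.mul_assoc, Matrix.mul_apply]
    refine Finset.sum_congr rfl fun p' _ => ?_
    rw [Matrix.mul_apply, Finset.mul_sum]
    refine Finset.sum_congr rfl fun q' _ => ?_
    have hupd : Function.update (Function.update (Function.update (Function.update x i p) j q) i p')
        j q' = Function.update (Function.update x i p') j q' := by
      funext l
      by_cases hlj : l = j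
      · simp [hlj]
      by_cases hli : l = i
      · simp [hli, hij]
      · simp [hli, hlj]
    rw [hupd, Function.update_of_ne hij, Function.update_self, Function.update_self,
      Matrix.transpose_apply]
    simp only [V, Matrix.of_apply]
    ring
  have hunit : ∀ a, (pauliMat a)ᵀ * ((pauliMat a)ᵀ)ᴴ = 1 := by
    intro a
    rw [show ((pauliMat a)ᵀ)ᴴ = ((pauliMat a)ᴴ)ᵀ from rfl, pauliMat_conjTranspose, ← Matrix.transpose_mul,
      pauliMat_mul_self, Matrix.transpose_one]
  have hPV := hV hP hPψ
  have hQV := hV hQ hQψ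
  rw [hPi] at hPV
  rw [hQi] at hQV
  obtain ⟨V₀, hV₀⟩ : ∃ V₀ : Matrix (Fin 2) (Fin 2) ℂ, ∀ x, ∃ s : ℂ, V x = s • V₀ := by
    by_cases h : ∃ x, V x ≠ 0
    · obtain ⟨x₀, hx₀⟩ := h
      exact ⟨V x₀, fun x => exists_smul_eq_of_pauli_invariant hα hβ (hunit _) (hunit _)
        (hPV x₀) (hPV x) (hQV x₀) (hQV x) hx₀⟩
    · push Not at h
      exact ⟨0, fun x => ⟨0, by rw [h x, smul_zero]⟩⟩
  choose s hs using hV₀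
  refine not_not_intro ⟨{i, j}, fun y => V₀ (y ⟨i, by simp⟩) (y ⟨j, by simp⟩),
    fun z => s (mergeAssign {i, j} 0 z), Finset.insert_ne_empty _ _, ?_, fun x => ?_⟩
  · intro h
    have := h ▸ Finset.mem_univ k
    simp [hki, hkj] at this
  · have hmerge : V (mergeAssign {i, j} 0 fun l => x l.1) = V x := by
      ext p q
      simp only [V, Matrix.of_apply]
      congr 1
      funext l
      by_cases hlj : l = j
      · simp [hlj]
      by_cases hli : l = i
      · simp [hli, hij]
      · simp [hli, hlj, mergeAssign]
    rw [← hVx x, ← hmerge, hs, Matrix.smul_apply, smul_eq_mul, mul_comm]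

end PairProduct

/-- If `ψ` is a fully entangled stabilizer state on `n ≥ 3` qubits whose
stabilizer corresponds to a GF(4)-linear code (closed under scalar multiplication by `ξ`),
then `LU(ψ) = LC(ψ)`. -/
theorem stmt_4 {n : ℕ} (hn : 3 ≤ n) (S : Stabilizer (Fin n)) (ψ : (Fin n → Fin 2) → ℂ)
    (hψ : stabilizesState S ψ) (hent : FullyEntangled ψ)
    (hlin : ∀ ξ : GaloisField 2 2, ξ ^ 2 = ξ + 1 →
      ∀ c ∈ gf4Code ξ S, (fun i => ξ * c i) ∈ gf4Code ξ S) :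
    ∀ φ : (Fin n → Fin 2) → ℂ, IsStabilizerState φ → (LUequiv ψ φ ↔ LCequiv ψ φ) := by
  rintro φ ⟨S', hφ⟩
  refine ⟨?_, fun ⟨U, hU, h⟩ => ⟨U, fun i => (hU i).1, h⟩⟩
  rintro ⟨U, hU, rfl⟩
  refine ⟨U, fun i => isClifford_of_one_le_abs_pauliRot (hU i) fun a _ => ?_, rfl⟩
  obtain ⟨ω, hi, hinj, hsurj⟩ := hψ.exists_minimal_support hlin i
  obtain ⟨j, hj, hcover⟩ : ∃ j, i ≠ j ∧
      ((∃ k, j ∈ ω ∧ k ∈ ω ∧ i ≠ k ∧ j ≠ k) ∨ ∀ l ∈ ω, l = i ∨ l = j) := by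
    by_cases h : ∃ j ∈ ω, i ≠ j
    · obtain ⟨j, hjω, hij⟩ := h
      refine ⟨j, hij, or_iff_not_imp_right.2 fun hne => ?_⟩
      push Not at hne
      obtain ⟨k, hk, hki, hkj⟩ := hne
      exact ⟨k, hjω, hk, hki.symm, hkj.symm⟩
    · push Not at h
      have : Nontrivial (Fin n) := Fin.nontrivial_iff_two_le.2 (by omega)
      obtain ⟨j, hj⟩ := exists_ne i
      exact ⟨j, hj.symm, Or.inr fun l hl => Or.inl (h l hl).symm⟩
  rcases hcover with ⟨k, hjω, hk, hik, hjk⟩ | hcover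
  · exact exists_one_le_abs_pauliRot hU hψ hφ hi hjω hk hj hik hjk hinj hsurj
  · obtain ⟨k, hk⟩ : ∃ k, k ∉ ({i, j} : Finset (Fin n)) := by
      by_contra! h
      have h1 := Finset.card_le_card fun x (_ : x ∈ Finset.univ) => h x
      rw [Finset.card_univ, Fintype.card_fin] at h1
      have h2 := Finset.card_le_two (a := i) (b := j)
      omega
    simp only [Finset.mem_insert, Finset.mem_singleton, not_or] at hk
    obtain ⟨P, hP, hPω, hPi⟩ := hsurj 1
    obtain ⟨Q, hQ, hQω, hQi⟩ := hsurj 3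
    obtain ⟨α, hα, hPψ⟩ := hψ.pauliString_mulVec hP
    obtain ⟨β, hβ, hQψ⟩ := hψ.pauliString_mulVec hQ
    have hoff : ∀ l, l ≠ i → l ≠ j → l ∉ ω := fun l hli hlj hl =>
      (hcover l hl).elim hli hlj
    exact absurd hent (not_fullyEntangled_of_pair hj hk.1 hk.2
      (fun l hli hlj => hPω l (hoff l hli hlj)) (fun l hli hlj => hQω l (hoff l hli hlj))
      hPi hQi hα hβ hPψ hQψ)
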